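/- Let Z⁺ ∈ S_{n,p}, X_i ∈ S_{n,p}, and let A_i ∈ ℝ^{n×m_i}, β_i > 0, c_i > 0, c_i' > 0 with β_i ≥ c_i'‖A_i‖₂², and σ̲ ∈ (0,1). Set Λ_i := Λ(X_i;A_i), H_i := A_i A_iᵀ + Λ_i + β_i Z⁺(Z⁺)ᵀ, and h_i(X) := −½ tr(Xᵀ H_i X). Assume distp(Z⁺, X_i)² ≤ 2(1 − σ̲²), and that X_i⁺ ∈ S_{n,p} satisfies h_i(X_i) − h_i(X_i⁺) ≥ (c_i/(c_i'‖A_i‖₂² + β_i)) ‖P_{X_i} H_i X_i‖²_F. Then: (a) h_i(X_i) − h_i(X_i⁺) ≥ (1/4) σ̲² c_i β_i · distp(Z⁺, X_i)²; and (b) distp(Z⁺, X_i⁺)² ≤ (1 − c_i σ̲²) distp(Z⁺, X_i)² + (12/β_i) √p ‖A_i‖²_F. -/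

import Mathlib

open Matrix BigOperators

/-- Frobenius norm of a real matrix. -/
noncomputable def frob {n m : ℕ} (A : Matrix (Fin n) (Fin m) ℝ) : ℝ :=
  Real.sqrt (∑ i, ∑ j, (A i j) ^ 2)

/-- Spectral (operator 2-) norm of a real matrix. -/
noncomputable def spec {n m : ℕ} (A : Matrix (Fin n) (Fin m) ℝ) : ℝ :=
  ‖LinearMap.toContinuousLinearMap (Matrix.toEuclideanLin A)‖

/-- Projection distance `distp(X,Z) = ‖XXᵀ − ZZᵀ‖_F`. -/
noncomputable def distp {n p : ℕ} (X Z : Matrix (Fin n) (Fin p) ℝ) : ℝ :=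
  frob (X * Xᵀ - Z * Zᵀ)

/-- The low-rank multiplier `Λ(X;A) = XW(X;A)ᵀ + W(X;A)Xᵀ` with
`W(X;A) = −(I − XXᵀ)AAᵀX`. -/
noncomputable def LamW {n p m : ℕ} (X : Matrix (Fin n) (Fin p) ℝ)
    (A : Matrix (Fin n) (Fin m) ℝ) : Matrix (Fin n) (Fin n) ℝ :=
  X * (-((1 - X * Xᵀ) * (A * Aᵀ) * X))ᵀ + (-((1 - X * Xᵀ) * (A * Aᵀ) * X)) * Xᵀ

/-- The local matrix `H = AAᵀ + Λ(X;A) + β Z⁺(Z⁺)ᵀ`. -/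
noncomputable def Hmat {n p m : ℕ} (X : Matrix (Fin n) (Fin p) ℝ)
    (A : Matrix (Fin n) (Fin m) ℝ) (β : ℝ)
    (Zplus : Matrix (Fin n) (Fin p) ℝ) : Matrix (Fin n) (Fin n) ℝ :=
  A * Aᵀ + LamW X A + β • (Zplus * Zplusᵀ)

/-- `h(X) = −½ tr(Xᵀ H X)`. -/
noncomputable def hfun {n p : ℕ} (H : Matrix (Fin n) (Fin n) ℝ)
    (X : Matrix (Fin n) (Fin p) ℝ) : ℝ :=
  -(1 / 2 : ℝ) * (Xᵀ * H * X).trace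

theorem frob_sq_eq_sum {n m : ℕ} (A : Matrix (Fin n) (Fin m) ℝ) :
    frob A ^ 2 = ∑ i, ∑ j, A i j ^ 2 :=
  Real.sq_sqrt (Finset.sum_nonneg fun i _ => Finset.sum_nonneg fun j _ => sq_nonneg (A i j))

theorem frob_sq {n m : ℕ} (A : Matrix (Fin n) (Fin m) ℝ) :
    frob A ^ 2 = (Aᵀ * A).trace := by
  rw [frob_sq_eq_sum, Finset.sum_comm]
  simp [Matrix.trace, Matrix.mul_apply, sq]

theorem frob_nonneg {n m : ℕ} (A : Matrix (Fin n) (Fin m) ℝ) : 0 ≤ frob A :=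
  Real.sqrt_nonneg _

theorem frob_transpose {n m : ℕ} (A : Matrix (Fin n) (Fin m) ℝ) : frob Aᵀ = frob A := by
  simp only [frob, Matrix.transpose_apply]
  rw [Finset.sum_comm]

section
attribute [local instance] Matrix.frobeniusNormedAddCommGroup

theorem frob_eq_norm {n m : ℕ} (A : Matrix (Fin n) (Fin m) ℝ) : frob A = ‖A‖ := by
  rw [Matrix.frobenius_norm_def, frob, Real.sqrt_eq_rpow]
  simp

theorem frob_mul_le {n m k : ℕ} (A : Matrix (Fin n) (Fin m) ℝ) (B : Matrix (Fin m) (Fin k) ℝ) :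
    frob (A * B) ≤ frob A * frob B := by
  simpa only [frob_eq_norm] using Matrix.frobenius_norm_mul A B

end

theorem abs_trace_mul_le {n m : ℕ} (A : Matrix (Fin m) (Fin n) ℝ) (B : Matrix (Fin n) (Fin m) ℝ) :
    |(A * B).trace| ≤ frob A * frob B := by
  refine abs_le_of_sq_le_sq ?_ (mul_nonneg (frob_nonneg _) (frob_nonneg _))
  rw [← frob_transpose B, mul_pow, frob_sq_eq_sum, frob_sq_eq_sum]
  simp only [Matrix.trace, Matrix.diag, Matrix.mul_apply, Matrix.transpose_apply,
    ← Finset.sum_product']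
  exact Finset.sum_mul_sq_le_sq_mul_sq _ _ _

/-- Left multiplication by an orthogonal projector does not increase the Frobenius norm. -/
theorem frob_proj_mul_le {n m : ℕ} {P : Matrix (Fin n) (Fin n) ℝ} (hT : Pᵀ = P) (hP : P * P = P)
    (N : Matrix (Fin n) (Fin m) ℝ) : frob (P * N) ≤ frob N := by
  refine le_of_sq_le_sq ?_ (frob_nonneg _)
  have h : frob N ^ 2 = frob (P * N) ^ 2 + frob ((1 - P) * N) ^ 2 := by
    simp only [frob_sq, ← Matrix.trace_add]
    congr 1
    have h1 : (P * N)ᵀ * (P * N) = Nᵀ * P * N := by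
      rw [Matrix.transpose_mul, hT, Matrix.mul_assoc, ← Matrix.mul_assoc P, hP, Matrix.mul_assoc]
    have h2 : ((1 - P) * N)ᵀ * ((1 - P) * N) = Nᵀ * ((1 - P) * (1 - P)) * N := by
      simp only [Matrix.transpose_mul, Matrix.transpose_sub, Matrix.transpose_one, hT,
        Matrix.mul_assoc]
    have h3 : (1 - P) * (1 - P) = 1 - P := IsIdempotentElem.one_sub hP
    rw [h1, h2, h3]
    simp [Matrix.mul_sub, Matrix.sub_mul]
  nlinarith [sq_nonneg (frob ((1 - P) * N))]

section Stiefel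
variable {n p : ℕ} {X Z : Matrix (Fin n) (Fin p) ℝ}

theorem stiefel_proj_idem (hX : Xᵀ * X = 1) : (X * Xᵀ) * (X * Xᵀ) = X * Xᵀ := by
  rw [Matrix.mul_assoc, ← Matrix.mul_assoc Xᵀ, hX, Matrix.one_mul]

theorem stiefel_proj_transpose (X : Matrix (Fin n) (Fin p) ℝ) : (X * Xᵀ)ᵀ = X * Xᵀ := by
  simp

theorem stiefel_proj_trace (hX : Xᵀ * X = 1) : (X * Xᵀ).trace = p := by
  rw [Matrix.trace_mul_comm, hX]; simp

theorem frob_stiefel_proj (hX : Xᵀ * X = 1) : frob (X * Xᵀ) = Real.sqrt p := by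
  rw [← Real.sqrt_sq (frob_nonneg (X * Xᵀ)), frob_sq, stiefel_proj_transpose,
    stiefel_proj_idem hX, stiefel_proj_trace hX]

theorem distp_sq (hX : Xᵀ * X = 1) (hZ : Zᵀ * Z = 1) :
    distp Z X ^ 2 = 2 * (p - ((X * Xᵀ) * (Z * Zᵀ)).trace) := by
  rw [distp, frob_sq, Matrix.transpose_sub, stiefel_proj_transpose, stiefel_proj_transpose,
    sub_mul, mul_sub, mul_sub, stiefel_proj_idem hX, stiefel_proj_idem hZ]
  simp only [Matrix.trace_sub, stiefel_proj_trace hX, stiefel_proj_trace hZ]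
  rw [Matrix.trace_mul_comm (Z * Zᵀ)]
  ring

/-- The component of `ZZᵀX` orthogonal to the range of `X` controls the projection distance. -/
theorem frob_proj_residual_ge (hX : Xᵀ * X = 1) (hZ : Zᵀ * Z = 1) {σ : ℝ}
    (hdist : distp Z X ^ 2 ≤ 2 * (1 - σ ^ 2)) :
    σ ^ 2 * distp Z X ^ 2 / 2 ≤ frob ((1 - X * Xᵀ) * (Z * Zᵀ) * X) ^ 2 := by
  rw [distp_sq hX hZ] at *
  have hP := stiefel_proj_idem hX
  have hQ := stiefel_proj_idem hZ
  have hPT := stiefel_proj_transpose X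
  have hQT := stiefel_proj_transpose Z
  have tQ := stiefel_proj_trace hZ
  have e1 : frob ((1 - X * Xᵀ) * (Z * Zᵀ) * X) ^ 2 =
      ((X * Xᵀ) * (Z * Zᵀ) * ((1 - X * Xᵀ) * (1 - X * Xᵀ)) * (Z * Zᵀ)).trace := by
    rw [frob_sq, Matrix.transpose_mul, ← Matrix.mul_assoc, Matrix.trace_mul_comm]
    rw [Matrix.transpose_mul, hQT, Matrix.transpose_sub, hPT, Matrix.transpose_one]
    simp only [Matrix.mul_assoc]
  have e2 : frob ((1 - X * Xᵀ) * Z) ^ 2 =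
      ((1 - X * Xᵀ) * (1 - X * Xᵀ) * (Z * Zᵀ)).trace := by
    rw [frob_sq, Matrix.transpose_mul, Matrix.transpose_sub, hPT, Matrix.transpose_one,
      Matrix.mul_assoc, Matrix.trace_mul_comm]
    simp only [Matrix.mul_assoc]
  have e3 : frob (((1 - X * Xᵀ) * Z)ᵀ * ((1 - X * Xᵀ) * Z)) ^ 2 =
      (((1 - X * Xᵀ) * (1 - X * Xᵀ)) * (Z * Zᵀ) *
        ((1 - X * Xᵀ) * (1 - X * Xᵀ)) * (Z * Zᵀ)).trace := by
    simp only [frob_sq, Matrix.transpose_mul, Matrix.transpose_transpose, Matrix.transpose_sub,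
      Matrix.transpose_one]
    rw [Matrix.mul_assoc, Matrix.mul_assoc, Matrix.trace_mul_comm]
    simp only [Matrix.mul_assoc]
  have hle := frob_mul_le ((1 - X * Xᵀ) * Z)ᵀ ((1 - X * Xᵀ) * Z)
  rw [frob_transpose] at hle
  have hle2 := pow_le_pow_left₀ (frob_nonneg _) hle 2
  have hg : (0:ℝ) ≤ frob ((1 - X * Xᵀ) * Z) ^ 2 := sq_nonneg _
  rw [← sq, e3, e2] at hle2
  rw [e2] at hg
  rw [e1]
  generalize X * Xᵀ = P at *
  generalize Z * Zᵀ = Q at *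
  have h3 : (1 - P) * (1 - P) = 1 - P := IsIdempotentElem.one_sub hP
  rw [h3] at hle2 hg ⊢
  have c1 : P * Q * (1 - P) * Q = P * Q - P * Q * P * Q := by
    rw [mul_sub, sub_mul, mul_one, mul_assoc P Q Q, hQ]
  have c2 : (1 - P) * Q * (1 - P) * Q = Q - P * Q - Q * P * Q + P * Q * P * Q := by
    have : (1 - P) * Q * (1 - P) * Q = Q * Q - P * (Q * Q) - Q * P * Q + P * Q * P * Q := by
      noncomm_ring
    rw [this, hQ]
  have c3 : (Q * P * Q).trace = (P * Q).trace := by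
    rw [mul_assoc, Matrix.trace_mul_comm, mul_assoc, hQ]
  rw [c1]
  rw [c2] at hle2
  rw [sub_mul, one_mul] at hle2 hg
  simp only [Matrix.trace_sub, Matrix.trace_add, c3, tQ] at *
  nlinarith

end Stiefel

section LocalMatrix
variable {n p m : ℕ} {X Y Z : Matrix (Fin n) (Fin p) ℝ} (A : Matrix (Fin n) (Fin m) ℝ)

/-- The multiplier cancels the data term in the projected gradient. -/
theorem proj_mul_Hmat_mul (hX : Xᵀ * X = 1) (β : ℝ) :
    (1 - X * Xᵀ) * Hmat X A β Z * X = β • ((1 - X * Xᵀ) * (Z * Zᵀ) * X) := by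
  have hPX : (1 - X * Xᵀ) * X = 0 := by
    rw [Matrix.sub_mul, Matrix.mul_assoc, hX]; simp
  have hPP : (1 - X * Xᵀ) * (1 - X * Xᵀ) = 1 - X * Xᵀ :=
    IsIdempotentElem.one_sub (stiefel_proj_idem hX)
  have h : (1 - X * Xᵀ) * LamW X A * X = -((1 - X * Xᵀ) * (A * Aᵀ) * X) := by
    rw [LamW, Matrix.mul_add, ← Matrix.mul_assoc, hPX, Matrix.zero_mul, zero_add,
      Matrix.mul_assoc, Matrix.mul_assoc, hX, Matrix.mul_one, Matrix.mul_neg]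
    simp only [← Matrix.mul_assoc, hPP]
  simp only [Hmat, Matrix.mul_add, Matrix.add_mul, h]
  simp

theorem hfun_eq (H : Matrix (Fin n) (Fin n) ℝ) :
    hfun H X = -(1 / 2 : ℝ) * (H * (X * Xᵀ)).trace := by
  rw [hfun, Matrix.mul_assoc, Matrix.trace_mul_comm, Matrix.mul_assoc]

theorem trace_LamW_mul {P : Matrix (Fin n) (Fin n) ℝ} (hP : Pᵀ = P) :
    (LamW X A * P).trace =
      -2 * ((A * Aᵀ) * ((1 - X * Xᵀ) * (P * (X * Xᵀ)))).trace := by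
  have h1 : ((-((1 - X * Xᵀ) * (A * Aᵀ) * X)) * Xᵀ * P).trace =
      -((A * Aᵀ) * ((X * Xᵀ) * (P * (1 - X * Xᵀ)))).trace := by
    simp only [Matrix.neg_mul, Matrix.trace_neg]
    rw [Matrix.mul_assoc, Matrix.mul_assoc, Matrix.mul_assoc, Matrix.trace_mul_comm]
    simp only [Matrix.mul_assoc]
  have h2 : ((A * Aᵀ) * ((X * Xᵀ) * (P * (1 - X * Xᵀ)))).trace =
      ((A * Aᵀ) * ((1 - X * Xᵀ) * (P * (X * Xᵀ)))).trace := by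
    rw [← Matrix.trace_transpose, Matrix.transpose_mul, Matrix.trace_mul_comm]
    simp only [Matrix.transpose_mul, Matrix.transpose_transpose, Matrix.transpose_sub,
      Matrix.transpose_one, hP, Matrix.mul_assoc]
  have h3 : (X * (-((1 - X * Xᵀ) * (A * Aᵀ) * X))ᵀ * P).trace =
      ((-((1 - X * Xᵀ) * (A * Aᵀ) * X)) * Xᵀ * P).trace := by
    rw [← Matrix.trace_transpose, Matrix.transpose_mul, Matrix.transpose_mul,
      Matrix.transpose_transpose, hP, Matrix.trace_mul_comm]
  rw [LamW, Matrix.add_mul, Matrix.trace_add, h3, h1, h2]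
  ring

theorem trace_data_add_multiplier_le (hX : Xᵀ * X = 1) (hY : Yᵀ * Y = 1) :
    ((A * Aᵀ + LamW X A) * (Y * Yᵀ)).trace - ((A * Aᵀ + LamW X A) * (X * Xᵀ)).trace
      ≤ 6 * Real.sqrt p * frob A ^ 2 := by
  have hPX : (1 - X * Xᵀ) * (X * Xᵀ) = 0 := by
    rw [sub_mul, stiefel_proj_idem hX]; simp
  have hPP : (1 - X * Xᵀ) * (1 - X * Xᵀ) = 1 - X * Xᵀ :=
    IsIdempotentElem.one_sub (stiefel_proj_idem hX)
  have hPT : (1 - X * Xᵀ)ᵀ = 1 - X * Xᵀ := by simp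
  have hM : frob (A * Aᵀ) ≤ frob A ^ 2 := by
    simpa [frob_transpose, sq] using frob_mul_le A Aᵀ
  have bound : ∀ N : Matrix (Fin n) (Fin n) ℝ, frob N ≤ Real.sqrt p →
      |((A * Aᵀ) * N).trace| ≤ Real.sqrt p * frob A ^ 2 := fun N hN =>
    (abs_trace_mul_le _ _).trans <| by
      rw [mul_comm]
      exact mul_le_mul hN hM (frob_nonneg _) (Real.sqrt_nonneg _)
  have b1 := abs_le.1 (bound (Y * Yᵀ) (frob_stiefel_proj hY).le)
  have b2 := abs_le.1 (bound (X * Xᵀ) (frob_stiefel_proj hX).le)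
  have b3 := abs_le.1 (bound ((1 - X * Xᵀ) * (Y * Yᵀ * (X * Xᵀ)))
    ((frob_proj_mul_le hPT hPP _).trans ((frob_proj_mul_le (stiefel_proj_transpose Y)
      (stiefel_proj_idem hY) _).trans (frob_stiefel_proj hX).le)))
  simp only [Matrix.add_mul, Matrix.trace_add,
    trace_LamW_mul A (stiefel_proj_transpose Y), trace_LamW_mul A (stiefel_proj_transpose X),
    stiefel_proj_idem hX, hPX, Matrix.mul_zero, Matrix.trace_zero]
  have := mul_nonneg (Real.sqrt_nonneg p) (sq_nonneg (frob A))
  linarith [b1.2, b2.1, b3.1]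

end LocalMatrix

/-- the sufficient function-value decrease condition for the local
subproblem yields (a) a decrease proportional to the consensus error, and (b) a
contraction of the consensus error. -/
theorem stmt13 {n p m : ℕ}
    (Zplus Xi Xiplus : Matrix (Fin n) (Fin p) ℝ)
    (A : Matrix (Fin n) (Fin m) ℝ)
    (β c c' σ : ℝ)
    (hZplus : Zplusᵀ * Zplus = 1)
    (hXi : Xiᵀ * Xi = 1) (hXiplus : Xiplusᵀ * Xiplus = 1)
    (hβ : 0 < β) (hc : 0 < c) (hc' : 0 < c')
    (hβA : β ≥ c' * spec A ^ 2)
    (hσ0 : 0 < σ) (hσ1 : σ < 1)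
    (hdist : distp Zplus Xi ^ 2 ≤ 2 * (1 - σ ^ 2))
    (hdec : hfun (Hmat Xi A β Zplus) Xi - hfun (Hmat Xi A β Zplus) Xiplus
      ≥ (c / (c' * spec A ^ 2 + β))
          * frob ((1 - Xi * Xiᵀ) * Hmat Xi A β Zplus * Xi) ^ 2) :
    hfun (Hmat Xi A β Zplus) Xi - hfun (Hmat Xi A β Zplus) Xiplus
        ≥ (1 / 4) * σ ^ 2 * c * β * distp Zplus Xi ^ 2
    ∧ distp Zplus Xiplus ^ 2
        ≤ (1 - c * σ ^ 2) * distp Zplus Xi ^ 2 + (12 / β) * Real.sqrt p * frob A ^ 2 := by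
  have hdecrease : hfun (Hmat Xi A β Zplus) Xi - hfun (Hmat Xi A β Zplus) Xiplus
      ≥ (1 / 4) * σ ^ 2 * c * β * distp Zplus Xi ^ 2 := by
    refine le_trans ?_ hdec
    have hfr : frob ((1 - Xi * Xiᵀ) * Hmat Xi A β Zplus * Xi) ^ 2 =
        β ^ 2 * frob ((1 - Xi * Xiᵀ) * (Zplus * Zplusᵀ) * Xi) ^ 2 := by
      rw [proj_mul_Hmat_mul A hXi, frob_sq, frob_sq]
      simp only [Matrix.transpose_smul, Matrix.smul_mul, Matrix.mul_smul, Matrix.trace_smul,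
        smul_eq_mul]
      ring
    have hres := frob_proj_residual_ge hXi hZplus hdist
    have hspec : 0 ≤ c' * spec A ^ 2 := by positivity
    have hcoef : c / (2 * β) ≤ c / (c' * spec A ^ 2 + β) :=
      div_le_div_of_nonneg_left hc.le (by linarith) (by linarith)
    rw [hfr]
    calc (1 / 4) * σ ^ 2 * c * β * distp Zplus Xi ^ 2
        = c / (2 * β) * (β ^ 2 * (σ ^ 2 * distp Zplus Xi ^ 2 / 2)) := by field_simp; ring
      _ ≤ _ := by gcongr
  refine ⟨hdecrease, ?_⟩
  have htr := trace_data_add_multiplier_le A hXi hXiplus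
  have dX := distp_sq hXi hZplus
  have dY := distp_sq hXiplus hZplus
  rw [hfun_eq, hfun_eq, Hmat, Matrix.add_mul, Matrix.add_mul _ _ (Xiplus * Xiplusᵀ),
    Matrix.trace_add, Matrix.trace_add] at hdecrease
  simp only [Matrix.smul_mul, Matrix.trace_smul, smul_eq_mul] at hdecrease
  rw [Matrix.trace_mul_comm] at dX dY
  have hmain : β * distp Zplus Xiplus ^ 2 ≤
      β * ((1 - c * σ ^ 2) * distp Zplus Xi ^ 2) + 12 * Real.sqrt p * frob A ^ 2 := by
    have tX : ((Zplus * Zplusᵀ) * (Xi * Xiᵀ)).trace = p - distp Zplus Xi ^ 2 / 2 := by linarith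
    have tY : ((Zplus * Zplusᵀ) * (Xiplus * Xiplusᵀ)).trace = p - distp Zplus Xiplus ^ 2 / 2 := by
      linarith
    rw [tX, tY] at hdecrease
    linarith
  have hdiv : (12 / β) * Real.sqrt p * frob A ^ 2 = 12 * Real.sqrt p * frob A ^ 2 / β := by ring
  rw [hdiv, ← sub_le_iff_le_add', le_div_iff₀ hβ]
  linarith
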